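/- arXiv:2407.08862 — 3 statements merged into one kernel-verified Lean document; each statement's English description precedes it below -/
import Mathlib

section
/- Let N ≥ 1 and let p01, p11, p00, p10 be positive real numbers with p01 + p11 + p00 + p10 = 1. Define the entropy function H(π, r0, r1) = −π·log π − (1−π)·log(1−π) − (1−π)·(r0·log r0 + (1−r0)·log(1−r0)) − π·(r1·log r1 + (1−r1)·log(1−r1)) for π, r0, r1 ∈ (0,1). Set π* = p11 + p10, r0* = p01/(p01 + p00), r1* = p11/(p11 + p10). Then for any family (π_i, r0_i, r1_i)_{i=1}^N of triples in (0,1)^3 satisfying the constraints (1/N)·∑_i (1−π_i)·r0_i = p01, (1/N)·∑_i π_i·r1_i = p11, (1/N)·∑_i (1−π_i)·(1−r0_i) = p00, and (1/N)·∑_i π_i·(1−r1_i) = p10, one has ∑_{i=1}^N H(π_i, r0_i, r1_i) ≤ N·H(π*, r0*, r1*), and equality holds if and only if (π_i, r0_i, r1_i) = (π*, r0*, r1*) for every i. -/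
open Real Set

/-- The entropy function `H(π, r0, r1)` from the propensity-prognosis model. -/
noncomputable def Hent (p r0 r1 : ℝ) : ℝ :=
  -p * Real.log p - (1 - p) * Real.log (1 - p)
    - (1 - p) * (r0 * Real.log r0 + (1 - r0) * Real.log (1 - r0))
    - p * (r1 * Real.log r1 + (1 - r1) * Real.log (1 - r1))

lemma cell_le {a q : ℝ} (ha : 0 < a) (hq : 0 < q) :
    -(a * Real.log a) ≤ -(a * Real.log q) + q - a := by
  have h := Real.log_le_sub_one_of_pos (div_pos hq ha)
  rw [Real.log_div hq.ne' ha.ne'] at h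
  have h2 := mul_le_mul_of_nonneg_left h ha.le
  have h3 : a * (q / a - 1) = q - a := by field_simp
  linarith

lemma cell_eq {a q : ℝ} (ha : 0 < a) (hq : 0 < q)
    (he : -(a * Real.log a) = -(a * Real.log q) + q - a) : a = q := by
  by_contra hne
  have h1 : q / a ≠ 1 := by
    intro h
    rw [div_eq_one_iff_eq ha.ne'] at h
    exact hne h.symm
  have h := Real.log_lt_sub_one_of_pos (div_pos hq ha) h1
  rw [Real.log_div hq.ne' ha.ne'] at h
  have h2 := mul_lt_mul_of_pos_left h ha
  have h3 : a * (q / a - 1) = q - a := by field_simp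
  linarith

lemma cell_sum {N : ℕ} (hN : 1 ≤ N) (a : Fin N → ℝ) (q : ℝ) (ha : ∀ i, 0 < a i) (hq : 0 < q)
    (hs : (∑ i, a i) / (N : ℝ) = q) :
    (∑ i, -(a i * Real.log (a i))) ≤ (N : ℝ) * -(q * Real.log q) ∧
    ((∑ i, -(a i * Real.log (a i))) = (N : ℝ) * -(q * Real.log q) → ∀ i, a i = q) := by
  have hN' : (N : ℝ) ≠ 0 := by positivity
  have hs' : ∑ i, a i = N * q := by
    rw [← hs]; field_simp
  have hr : ∑ i, (-(a i * Real.log q) + q - a i) = (N : ℝ) * -(q * Real.log q) := by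
    rw [Finset.sum_sub_distrib, Finset.sum_add_distrib, Finset.sum_neg_distrib,
      ← Finset.sum_mul, hs']
    simp
    ring
  rw [← hr]
  refine ⟨Finset.sum_le_sum fun i _ => cell_le (ha i) hq, fun h i => ?_⟩
  have := (Finset.sum_eq_sum_iff_of_le (fun i _ => cell_le (ha i) hq)).1 h i (Finset.mem_univ i)
  exact cell_eq (ha i) hq this

lemma Hent_eq {p r s : ℝ} (hp : p ∈ Set.Ioo (0 : ℝ) 1) (hr : r ∈ Set.Ioo (0 : ℝ) 1)
    (hs : s ∈ Set.Ioo (0 : ℝ) 1) :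
    Hent p r s = -(((1 - p) * r) * Real.log ((1 - p) * r)) + -((p * s) * Real.log (p * s))
      + -(((1 - p) * (1 - r)) * Real.log ((1 - p) * (1 - r)))
      + -((p * (1 - s)) * Real.log (p * (1 - s))) := by
  have h1 : 1 - p ≠ 0 := (sub_pos.2 hp.2).ne'
  have h2 : 1 - r ≠ 0 := (sub_pos.2 hr.2).ne'
  have h3 : 1 - s ≠ 0 := (sub_pos.2 hs.2).ne'
  rw [Real.log_mul h1 hr.1.ne', Real.log_mul hp.1.ne' hs.1.ne', Real.log_mul h1 h2,
    Real.log_mul hp.1.ne' h3, Hent]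
  ring

/-- **Homogeneous Effects (Theorem 1).** Under the four frequency-matching constraints,
the sum of individual entropies is maximized exactly at the single point-mass
`(π*, r0*, r1*) = (p11 + p10, p01/(p01+p00), p11/(p11+p10))`. -/
theorem homogeneous_effects
    (N : ℕ) (hN : 1 ≤ N)
    (p01 p11 p00 p10 : ℝ)
    (hp01 : 0 < p01) (hp11 : 0 < p11) (hp00 : 0 < p00) (hp10 : 0 < p10)
    (hsum : p01 + p11 + p00 + p10 = 1)
    (pp r0 r1 : Fin N → ℝ)
    (hpp : ∀ i, pp i ∈ Set.Ioo (0 : ℝ) 1)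
    (hr0 : ∀ i, r0 i ∈ Set.Ioo (0 : ℝ) 1)
    (hr1 : ∀ i, r1 i ∈ Set.Ioo (0 : ℝ) 1)
    (c1 : (∑ i, (1 - pp i) * r0 i) / (N : ℝ) = p01)
    (c2 : (∑ i, pp i * r1 i) / (N : ℝ) = p11)
    (c3 : (∑ i, (1 - pp i) * (1 - r0 i)) / (N : ℝ) = p00)
    (c4 : (∑ i, pp i * (1 - r1 i)) / (N : ℝ) = p10) :
    (∑ i, Hent (pp i) (r0 i) (r1 i))
        ≤ (N : ℝ) * Hent (p11 + p10) (p01 / (p01 + p00)) (p11 / (p11 + p10)) ∧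
    ((∑ i, Hent (pp i) (r0 i) (r1 i))
        = (N : ℝ) * Hent (p11 + p10) (p01 / (p01 + p00)) (p11 / (p11 + p10)) ↔
      ∀ i, pp i = p11 + p10 ∧ r0 i = p01 / (p01 + p00) ∧ r1 i = p11 / (p11 + p10)) := by
  have hq0 : 0 < p01 + p00 := by linarith
  have hq1 : 0 < p11 + p10 := by linarith
  have hc : 1 - (p11 + p10) = p01 + p00 := by linarith
  have e1 : (1 - (p11 + p10)) * (p01 / (p01 + p00)) = p01 := by rw [hc]; field_simp
  have e2 : (p11 + p10) * (p11 / (p11 + p10)) = p11 := by field_simp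
  have e3 : (1 - (p11 + p10)) * (1 - p01 / (p01 + p00)) = p00 := by
    rw [mul_sub, e1]; linarith
  have e4 : (p11 + p10) * (1 - p11 / (p11 + p10)) = p10 := by
    rw [mul_sub, e2]; linarith
  have hH : Hent (p11 + p10) (p01 / (p01 + p00)) (p11 / (p11 + p10))
      = -(p01 * Real.log p01) + -(p11 * Real.log p11) + -(p00 * Real.log p00)
        + -(p10 * Real.log p10) := by
    rw [Hent_eq ⟨hq1, by linarith⟩ ⟨by positivity, by rw [div_lt_one hq0]; linarith⟩
      ⟨by positivity, by rw [div_lt_one hq1]; linarith⟩, e1, e2, e3, e4]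
  have hS : ∑ i, Hent (pp i) (r0 i) (r1 i) = _ :=
    Finset.sum_congr rfl fun i _ => Hent_eq (hpp i) (hr0 i) (hr1 i)
  rw [Finset.sum_add_distrib, Finset.sum_add_distrib, Finset.sum_add_distrib] at hS
  obtain ⟨l1, q1⟩ := cell_sum hN (fun i => (1 - pp i) * r0 i) p01
    (fun i => mul_pos (sub_pos.2 (hpp i).2) (hr0 i).1) hp01 c1
  obtain ⟨l2, q2⟩ := cell_sum hN (fun i => pp i * r1 i) p11
    (fun i => mul_pos (hpp i).1 (hr1 i).1) hp11 c2
  obtain ⟨l3, q3⟩ := cell_sum hN (fun i => (1 - pp i) * (1 - r0 i)) p00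
    (fun i => mul_pos (sub_pos.2 (hpp i).2) (sub_pos.2 (hr0 i).2)) hp00 c3
  obtain ⟨l4, q4⟩ := cell_sum hN (fun i => pp i * (1 - r1 i)) p10
    (fun i => mul_pos (hpp i).1 (sub_pos.2 (hr1 i).2)) hp10 c4
  refine ⟨by rw [hS, hH]; linarith, fun h => ?_, fun h => ?_⟩
  · rw [hS, hH] at h
    have f1 := q1 (by linarith)
    have f2 := q2 (by linarith)
    have f3 := q3 (by linarith)
    have f4 := q4 (by linarith)
    intro i
    have g1 := f1 i
    have g2 := f2 i
    have g3 := f3 i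
    have g4 := f4 i
    have hp : pp i = p11 + p10 := by linarith
    refine ⟨hp, ?_, ?_⟩
    · rw [eq_div_iff hq0.ne', ← hc, ← hp]; linarith
    · rw [eq_div_iff hq1.ne', ← hp]; linarith
  · rw [Finset.sum_congr rfl fun i _ => by rw [(h i).1, (h i).2.1, (h i).2.2]]
    simp
end

section
/- Let d ≥ 1 and for each category c ∈ {1,…,d} let N_c ≥ 1 and let p01_c, p11_c, p00_c, p10_c be positive reals with p01_c + p11_c + p00_c + p10_c = 1. Define H(π, r0, r1) = −π·log π − (1−π)·log(1−π) − (1−π)·(r0·log r0 + (1−r0)·log(1−r0)) − π·(r1·log r1 + (1−r1)·log(1−r1)) for π, r0, r1 ∈ (0,1). For each c set π*_c = p11_c + p10_c, r0*_c = p01_c/(p01_c + p00_c), r1*_c = p11_c/(p11_c + p10_c). Then for any family of triples (π_{c,i}, r0_{c,i}, r1_{c,i}) ∈ (0,1)^3, indexed by c ∈ {1,…,d} and i ∈ {1,…,N_c}, satisfying for every c the constraints (1/N_c)·∑_i (1−π_{c,i})·r0_{c,i} = p01_c, (1/N_c)·∑_i π_{c,i}·r1_{c,i} = p11_c, (1/N_c)·∑_i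 (1−π_{c,i})·(1−r0_{c,i}) = p00_c, and (1/N_c)·∑_i π_{c,i}·(1−r1_{c,i}) = p10_c, one has ∑_c ∑_i H(π_{c,i}, r0_{c,i}, r1_{c,i}) ≤ ∑_c N_c·H(π*_c, r0*_c, r1*_c), with equality if and only if (π_{c,i}, r0_{c,i}, r1_{c,i}) = (π*_c, r0*_c, r1*_c) for every c and i. -/
open Real Set

/-- Pointwise relative-entropy gap. -/
noncomputable def gapKL (q p : ℝ) : ℝ := q * Real.log q - q * Real.log p + p - q

theorem gapKL_nonneg {q p : ℝ} (hq : 0 < q) (hp : 0 < p) : 0 ≤ gapKL q p := by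
  have h := Real.log_le_sub_one_of_pos (div_pos hp hq)
  rw [Real.log_div hp.ne' hq.ne'] at h
  have h2 := mul_le_mul_of_nonneg_left h hq.le
  have h3 : q * (p / q - 1) = p - q := by field_simp
  unfold gapKL
  linarith

theorem gapKL_eq_zero {q p : ℝ} (hq : 0 < q) (hp : 0 < p) (h0 : gapKL q p = 0) : q = p := by
  by_contra hne
  have h1 : p / q ≠ 1 := by
    intro h
    rw [div_eq_one_iff_eq hq.ne'] at h
    exact hne h.symm
  have h := Real.log_lt_sub_one_of_pos (div_pos hp hq) h1
  rw [Real.log_div hp.ne' hq.ne'] at h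
  have h2 := mul_lt_mul_of_pos_left h hq
  have h3 : q * (p / q - 1) = p - q := by field_simp
  unfold gapKL at h0
  linarith

/-- Chain rule: `Hent` is the entropy of the four joint cell probabilities. -/
theorem Hent_cells {p r0 r1 : ℝ} (hp : p ∈ Set.Ioo (0 : ℝ) 1) (h0 : r0 ∈ Set.Ioo (0 : ℝ) 1)
    (h1 : r1 ∈ Set.Ioo (0 : ℝ) 1) :
    Hent p r0 r1 = -(((1 - p) * r0) * Real.log ((1 - p) * r0)
      + (p * r1) * Real.log (p * r1)
      + ((1 - p) * (1 - r0)) * Real.log ((1 - p) * (1 - r0))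
      + (p * (1 - r1)) * Real.log (p * (1 - r1))) := by
  have a := hp.1.ne'
  have b := (sub_pos.2 hp.2).ne'
  have c := h0.1.ne'
  have d := (sub_pos.2 h0.2).ne'
  have e := h1.1.ne'
  have f := (sub_pos.2 h1.2).ne'
  rw [Real.log_mul b c, Real.log_mul a e, Real.log_mul b d, Real.log_mul a f]
  unfold Hent
  ring

theorem Hent_star {a b c e : ℝ} (ha : 0 < a) (hb : 0 < b) (hc : 0 < c) (he : 0 < e)
    (hs : a + b + c + e = 1) :
    Hent (b + e) (a / (a + c)) (b / (b + e)) =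
      -(a * Real.log a + b * Real.log b + c * Real.log c + e * Real.log e) := by
  have hac : 0 < a + c := by positivity
  have hbe : 0 < b + e := by positivity
  rw [Hent_cells ⟨hbe, by linarith⟩
    ⟨by positivity, by rw [div_lt_one hac]; linarith⟩
    ⟨by positivity, by rw [div_lt_one hbe]; linarith⟩]
  have e0 : 1 - (b + e) = a + c := by linarith
  have e1 : (a + c) * (a / (a + c)) = a := by field_simp
  have e2 : (b + e) * (b / (b + e)) = b := by field_simp
  have e3 : (a + c) * (1 - a / (a + c)) = c := by rw [mul_sub, e1]; ring
  have e4 : (b + e) * (1 - b / (b + e)) = e := by rw [mul_sub, e2]; ring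
  rw [e0, e1, e2, e3, e4]

/-- Total gap over the four cells. -/
noncomputable def gapCells (p r0 r1 a b c e : ℝ) : ℝ :=
  gapKL ((1 - p) * r0) a + gapKL (p * r1) b + gapKL ((1 - p) * (1 - r0)) c
    + gapKL (p * (1 - r1)) e

theorem gapCells_nonneg {p r0 r1 a b c e : ℝ} (hp : p ∈ Set.Ioo (0 : ℝ) 1)
    (h0 : r0 ∈ Set.Ioo (0 : ℝ) 1) (h1 : r1 ∈ Set.Ioo (0 : ℝ) 1)
    (ha : 0 < a) (hb : 0 < b) (hc : 0 < c) (he : 0 < e) :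
    0 ≤ gapCells p r0 r1 a b c e ∧ (gapCells p r0 r1 a b c e = 0 →
      p = b + e ∧ r0 = a / (a + c) ∧ r1 = b / (b + e)) := by
  have k1 := mul_pos (sub_pos.2 hp.2) h0.1
  have k2 := mul_pos hp.1 h1.1
  have k3 := mul_pos (sub_pos.2 hp.2) (sub_pos.2 h0.2)
  have k4 := mul_pos hp.1 (sub_pos.2 h1.2)
  have g1 := gapKL_nonneg k1 ha
  have g2 := gapKL_nonneg k2 hb
  have g3 := gapKL_nonneg k3 hc
  have g4 := gapKL_nonneg k4 he
  unfold gapCells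
  refine ⟨by linarith, fun h => ?_⟩
  have m1 := gapKL_eq_zero k1 ha (by linarith)
  have m2 := gapKL_eq_zero k2 hb (by linarith)
  have m3 := gapKL_eq_zero k3 hc (by linarith)
  have m4 := gapKL_eq_zero k4 he (by linarith)
  have hpe : p = b + e := by linarith
  have hqe : 1 - p = a + c := by linarith
  refine ⟨hpe, ?_, ?_⟩
  · rw [eq_div_iff (by positivity), ← hqe]; linarith
  · rw [eq_div_iff (by positivity), ← hpe]; linarith

/-- **Conditional Homogeneous Effects.** With individuals partitioned into `d` covariate
categories with category-wise joint frequencies, the maximum-entropy solution is a mixture of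
single point masses, one per category, at
`(π*_c, r0*_c, r1*_c) = (p11_c + p10_c, p01_c/(p01_c+p00_c), p11_c/(p11_c+p10_c))`. -/
theorem conditional_homogeneous_effects
    (d : ℕ) (hd : 1 ≤ d)
    (N : Fin d → ℕ) (hN : ∀ c, 1 ≤ N c)
    (p01 p11 p00 p10 : Fin d → ℝ)
    (hp01 : ∀ c, 0 < p01 c) (hp11 : ∀ c, 0 < p11 c)
    (hp00 : ∀ c, 0 < p00 c) (hp10 : ∀ c, 0 < p10 c)
    (hsum : ∀ c, p01 c + p11 c + p00 c + p10 c = 1)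
    (pp r0 r1 : (c : Fin d) → Fin (N c) → ℝ)
    (hpp : ∀ c i, pp c i ∈ Set.Ioo (0 : ℝ) 1)
    (hr0 : ∀ c i, r0 c i ∈ Set.Ioo (0 : ℝ) 1)
    (hr1 : ∀ c i, r1 c i ∈ Set.Ioo (0 : ℝ) 1)
    (c1 : ∀ c, (∑ i, (1 - pp c i) * r0 c i) / (N c : ℝ) = p01 c)
    (c2 : ∀ c, (∑ i, pp c i * r1 c i) / (N c : ℝ) = p11 c)
    (c3 : ∀ c, (∑ i, (1 - pp c i) * (1 - r0 c i)) / (N c : ℝ) = p00 c)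
    (c4 : ∀ c, (∑ i, pp c i * (1 - r1 c i)) / (N c : ℝ) = p10 c) :
    (∑ c, ∑ i, Hent (pp c i) (r0 c i) (r1 c i))
        ≤ ∑ c, (N c : ℝ) *
            Hent (p11 c + p10 c) (p01 c / (p01 c + p00 c)) (p11 c / (p11 c + p10 c)) ∧
    ((∑ c, ∑ i, Hent (pp c i) (r0 c i) (r1 c i))
        = ∑ c, (N c : ℝ) *
            Hent (p11 c + p10 c) (p01 c / (p01 c + p00 c)) (p11 c / (p11 c + p10 c)) ↔
      ∀ c i, pp c i = p11 c + p10 c ∧ r0 c i = p01 c / (p01 c + p00 c) ∧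
        r1 c i = p11 c / (p11 c + p10 c)) := by
  have key : ∀ c, (N c : ℝ) *
      Hent (p11 c + p10 c) (p01 c / (p01 c + p00 c)) (p11 c / (p11 c + p10 c))
      = (∑ i, Hent (pp c i) (r0 c i) (r1 c i))
        + ∑ i, gapCells (pp c i) (r0 c i) (r1 c i) (p01 c) (p11 c) (p00 c) (p10 c) := by
    intro c
    have hNc : (N c : ℝ) ≠ 0 := by
      have := hN c
      positivity
    have s1 := (div_eq_iff hNc).1 (c1 c)
    have s2 := (div_eq_iff hNc).1 (c2 c)
    have s3 := (div_eq_iff hNc).1 (c3 c)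
    have s4 := (div_eq_iff hNc).1 (c4 c)
    rw [Hent_star (hp01 c) (hp11 c) (hp00 c) (hp10 c) (hsum c), ← Finset.sum_add_distrib]
    have hterm : ∀ i, Hent (pp c i) (r0 c i) (r1 c i)
        + gapCells (pp c i) (r0 c i) (r1 c i) (p01 c) (p11 c) (p00 c) (p10 c)
        = -(((1 - pp c i) * r0 c i) * Real.log (p01 c) + (pp c i * r1 c i) * Real.log (p11 c)
          + ((1 - pp c i) * (1 - r0 c i)) * Real.log (p00 c)
          + (pp c i * (1 - r1 c i)) * Real.log (p10 c)) := by
      intro i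
      rw [Hent_cells (hpp c i) (hr0 c i) (hr1 c i)]
      unfold gapCells gapKL
      linear_combination hsum c
    rw [Finset.sum_congr rfl (fun i _ => hterm i), Finset.sum_neg_distrib]
    simp only [Finset.sum_add_distrib, ← Finset.sum_mul]
    rw [s1, s2, s3, s4]
    ring
  have hg := fun c i => gapCells_nonneg (hpp c i) (hr0 c i) (hr1 c i)
    (hp01 c) (hp11 c) (hp00 c) (hp10 c)
  have hgc : ∀ c, 0 ≤ ∑ i, gapCells (pp c i) (r0 c i) (r1 c i) (p01 c) (p11 c) (p00 c) (p10 c) :=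
    fun c => Finset.sum_nonneg fun i _ => (hg c i).1
  constructor
  · refine Finset.sum_le_sum fun c _ => ?_
    rw [key c]
    linarith [hgc c]
  · constructor
    · intro h c i
      rw [Finset.sum_congr rfl (fun c _ => key c), Finset.sum_add_distrib] at h
      have h0 : ∑ c, ∑ i,
          gapCells (pp c i) (r0 c i) (r1 c i) (p01 c) (p11 c) (p00 c) (p10 c) = 0 := by
        linarith
      have h1 := (Finset.sum_eq_zero_iff_of_nonneg (fun c _ => hgc c)).1 h0 c (Finset.mem_univ c)
      have h2 := (Finset.sum_eq_zero_iff_of_nonneg (fun i _ => (hg c i).1)).1 h1 i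
        (Finset.mem_univ i)
      exact (hg c i).2 h2
    · intro h
      refine Finset.sum_congr rfl fun c _ => ?_
      rw [Finset.sum_congr rfl (fun i _ => by rw [(h c i).1, (h c i).2.1, (h c i).2.2])]
      simp
end

section
/- Let μ be a probability measure on the interval [0,1] (the distribution of latent propensity probabilities π) and let π̄ = ∫ π dμ, assumed to satisfy 0 < π̄ < 1. Define the theoretical Tjur pseudo-R² parameter R²_{t;π,e} = (1/π̄)·∫ π² dμ − (1/(1−π̄))·∫ (1−π)·π dμ, and let σ²_π = ∫ π² dμ − π̄² be the variance of π under μ. Then R²_{t;π,e} = σ²_π / (π̄·(1−π̄)). -/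
open MeasureTheory Set

/-- **Proportion of Variation Explained (Theorem 2).** For a probability measure `μ` on `[0,1]`
(the distribution of latent propensity probabilities `π`) with mean `π̄ ∈ (0,1)`, Tjur's
theoretical pseudo-R² parameter
`R²_{t;π,e} = (1/π̄)·∫ π² dμ − (1/(1−π̄))·∫ (1−π)·π dμ`
equals `σ²_π / (π̄·(1−π̄))`, where `σ²_π = ∫ π² dμ − π̄²` is the variance of `π` under `μ`. -/
theorem tjur_pseudo_R2_propensity
    (μ : Measure ℝ) [IsProbabilityMeasure μ]
    (hsupp : μ (Set.Icc (0 : ℝ) 1)ᶜ = 0)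
    (hmean_pos : 0 < ∫ x, x ∂μ) (hmean_lt : ∫ x, x ∂μ < 1) :
    (1 / ∫ x, x ∂μ) * (∫ x, x ^ 2 ∂μ)
        - (1 / (1 - ∫ x, x ∂μ)) * (∫ x, (1 - x) * x ∂μ)
      = ((∫ x, x ^ 2 ∂μ) - (∫ x, x ∂μ) ^ 2) / ((∫ x, x ∂μ) * (1 - ∫ x, x ∂μ)) := by
  have hae : ∀ᵐ x ∂μ, x ∈ Set.Icc (0 : ℝ) 1 := by
    rw [ae_iff]
    exact hsupp
  have h1 : Integrable (fun x : ℝ => x) μ := by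
    refine Integrable.of_bound (by fun_prop) 1 ?_
    filter_upwards [hae] with x hx
    rw [Real.norm_eq_abs, abs_le]
    exact ⟨by linarith [hx.1], hx.2⟩
  have h2 : Integrable (fun x : ℝ => x ^ 2) μ := by
    refine Integrable.of_bound (by fun_prop) 1 ?_
    filter_upwards [hae] with x hx
    rw [Real.norm_eq_abs, abs_le]
    exact ⟨by nlinarith [hx.1], by nlinarith [hx.1, hx.2]⟩
  have h3 : ∫ x, (1 - x) * x ∂μ = (∫ x, x ∂μ) - ∫ x, x ^ 2 ∂μ := by
    rw [← integral_sub h1 h2]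
    congr 1
    ext x
    ring
  rw [h3]
  generalize (∫ x, x ∂μ) = m at *
  generalize (∫ x, x ^ 2 ∂μ) = s at *
  have hm : m ≠ 0 := hmean_pos.ne'
  have hm' : 1 - m ≠ 0 := (sub_pos.mpr hmean_lt).ne'
  field_simp
  ring
end
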